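/- arXiv:1811.08324 — 4 statements merged into one kernel-verified Lean document; each statement's English description precedes it below -/
import Mathlib

section
/- Let σ₁, σ₂, σ₃ be nonzero real numbers with κ̃ := (σ₁+σ₂)(σ₂+σ₃)(σ₃+σ₁) ≠ 0. Then there exist ε > 0 and c > 0, depending only on σ₁, σ₂, σ₃, such that for all τ₁, τ₂, τ₃ ∈ ℝ with τ₁+τ₂+τ₃ = 0 and all ξ₁, ξ₂, ξ₃ ∈ ℝ² with ξ₁+ξ₂+ξ₃ = 0, the following holds: if |ξ_i| ≤ ε|ξ_j| for some indices i, j ∈ {1,2,3}, then max_{1≤k≤3} |τ_k + σ_k|ξ_k|²| ≥ c · max_{1≤k≤3} |ξ_k|². -/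
/-- Euclidean norm on ℝ². -/
noncomputable def nrm2 (x : ℝ × ℝ) : ℝ := Real.sqrt (x.1 ^ 2 + x.2 ^ 2)

theorem nrm2_eq_norm_complex (x : ℝ × ℝ) : nrm2 x = ‖(⟨x.1, x.2⟩ : ℂ)‖ := by
  rw [Complex.norm_eq_sqrt_sq_add_sq, nrm2]

theorem nrm2_nonneg (x : ℝ × ℝ) : 0 ≤ nrm2 x := Real.sqrt_nonneg _

theorem abs_nrm2_sub_le_of_add_eq_zero {x y z : ℝ × ℝ} (h : x + y + z = 0) :
    |nrm2 y - nrm2 z| ≤ nrm2 x := by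
  have hx : x.1 = -(y.1 + z.1) ∧ x.2 = -(y.2 + z.2) := by
    have h1 := congrArg Prod.fst h
    have h2 := congrArg Prod.snd h
    simp only [Prod.fst_add, Prod.snd_add, Prod.fst_zero, Prod.snd_zero] at h1 h2
    constructor <;> linarith
  have key := abs_norm_sub_norm_le (⟨y.1, y.2⟩ : ℂ) (-⟨z.1, z.2⟩)
  have e : (⟨x.1, x.2⟩ : ℂ) = -(⟨y.1, y.2⟩ - -⟨z.1, z.2⟩) := by
    apply Complex.ext <;> simp [hx.1, hx.2]
  rwa [norm_neg, ← norm_neg (_ - _), ← e, ← nrm2_eq_norm_complex, ← nrm2_eq_norm_complex,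
    ← nrm2_eq_norm_complex] at key

/-- Lower bound for the resonance function when the frequency of size `x` is small compared with
the other two. -/
theorem resonance_lower_bound {s a b x y z S δ ε : ℝ} (hx : 0 ≤ x) (hy : 0 ≤ y) (hz : 0 ≤ z)
    (hyz : |y - z| ≤ x) (hS : |s| + |a| + |b| ≤ S) (hδ : δ ≤ |a + b|) (hε : 0 < ε)
    (hε' : ε ≤ 1 / 4) (hεS : 8 * S * ε ≤ δ) (h : x ≤ ε * x ∨ x ≤ ε * y ∨ x ≤ ε * z) :
    x ^ 2 ≤ y ^ 2 + z ^ 2 ∧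
      δ / 4 * (y ^ 2 + z ^ 2) ≤ |s * x ^ 2 + a * y ^ 2 + b * z ^ 2| := by
  have hN : 0 ≤ y ^ 2 + z ^ 2 := by positivity
  have hxy : x ≤ ε * (y + z) := by
    have := mul_nonneg hε.le hy
    have := mul_nonneg hε.le hz
    rcases h with h | h | h <;> nlinarith
  have hx2 : x ^ 2 ≤ ε * (y ^ 2 + z ^ 2) := by
    have h1 : x ^ 2 ≤ (ε * (y + z)) ^ 2 := pow_le_pow_left₀ hx hxy 2
    have h2 : (y + z) ^ 2 ≤ 2 * (y ^ 2 + z ^ 2) := by nlinarith [sq_nonneg (y - z)]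
    have h3 : ε ^ 2 * (y + z) ^ 2 ≤ ε ^ 2 * (2 * (y ^ 2 + z ^ 2)) := by gcongr
    have h4 : ε * (2 * ε) * (y ^ 2 + z ^ 2) ≤ ε * 1 * (y ^ 2 + z ^ 2) := by
      gcongr
      linarith
    nlinarith
  have hdiff : |y ^ 2 - z ^ 2| ≤ 2 * ε * (y ^ 2 + z ^ 2) := by
    have e : y ^ 2 - z ^ 2 = (y - z) * (y + z) := by ring
    rw [e, abs_mul, abs_of_nonneg (add_nonneg hy hz)]
    calc |y - z| * (y + z) ≤ ε * (y + z) * (y + z) := by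
          gcongr
          exact hyz.trans hxy
      _ = ε * (y + z) ^ 2 := by ring
      _ ≤ ε * (2 * (y ^ 2 + z ^ 2)) := by
          gcongr
          nlinarith [sq_nonneg (y - z)]
      _ = _ := by ring
  refine ⟨by nlinarith, ?_⟩
  have hmain : |(a + b) * (y ^ 2 + z ^ 2)| ≤
      2 * |s * x ^ 2 + a * y ^ 2 + b * z ^ 2| + 2 * (|s| * x ^ 2) +
        (|a| + |b|) * |y ^ 2 - z ^ 2| := by
    have e : (a + b) * (y ^ 2 + z ^ 2) =
        2 * (s * x ^ 2 + a * y ^ 2 + b * z ^ 2) - 2 * (s * x ^ 2) -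
          (a - b) * (y ^ 2 - z ^ 2) := by ring
    rw [e]
    refine (abs_sub _ _).trans (add_le_add ((abs_sub _ _).trans (add_le_add ?_ ?_)) ?_)
    · simp [abs_mul]
    · simp [abs_mul]
    · rw [abs_mul]
      gcongr
      exact abs_sub _ _
  rw [abs_mul, abs_of_nonneg hN] at hmain
  have h1 : δ * (y ^ 2 + z ^ 2) ≤ |a + b| * (y ^ 2 + z ^ 2) := by gcongr
  have h2 : |s| * x ^ 2 ≤ |s| * (ε * (y ^ 2 + z ^ 2)) := by gcongr
  have h3 : (|a| + |b|) * |y ^ 2 - z ^ 2| ≤ (|a| + |b|) * (2 * ε * (y ^ 2 + z ^ 2)) := by gcongr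
  have hεN := mul_nonneg hε.le hN
  have h4 : (|s| + |a| + |b|) * (ε * (y ^ 2 + z ^ 2)) ≤ S * (ε * (y ^ 2 + z ^ 2)) := by gcongr
  have hδN : 0 ≤ δ * (y ^ 2 + z ^ 2) := by
    have hS0 : 0 ≤ S := le_trans (by positivity) hS
    exact mul_nonneg (le_trans (by positivity) hεS) hN
  have h5 : 8 * S * ε * (y ^ 2 + z ^ 2) ≤ δ * (y ^ 2 + z ^ 2) := by gcongr
  linarith

/-- Let σ₁, σ₂, σ₃ be nonzero reals with
κ̃ := (σ₁+σ₂)(σ₂+σ₃)(σ₃+σ₁) ≠ 0. Then there exist ε > 0 and c > 0, depending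
only on σ₁, σ₂, σ₃, such that for all τ₁,τ₂,τ₃ ∈ ℝ with τ₁+τ₂+τ₃ = 0 and all
ξ₁,ξ₂,ξ₃ ∈ ℝ² with ξ₁+ξ₂+ξ₃ = 0: if |ξ_i| ≤ ε|ξ_j| for some indices i,j, then
max_k |τ_k + σ_k|ξ_k|²| ≥ c · max_k |ξ_k|².
(The conclusion "max_k LHS_k ≥ c · max_m RHS_m" is expressed as
"∀ m, ∃ k, c · RHS_m ≤ LHS_k".) -/
theorem stmt1 (σ : Fin 3 → ℝ) (hσ : ∀ k, σ k ≠ 0)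
    (hκ : (σ 0 + σ 1) * (σ 1 + σ 2) * (σ 2 + σ 0) ≠ 0) :
    ∃ ε > (0 : ℝ), ∃ c > (0 : ℝ),
      ∀ (τ : Fin 3 → ℝ) (ξ : Fin 3 → ℝ × ℝ),
        τ 0 + τ 1 + τ 2 = 0 → ξ 0 + ξ 1 + ξ 2 = 0 →
        (∃ i j : Fin 3, nrm2 (ξ i) ≤ ε * nrm2 (ξ j)) →
        ∀ m : Fin 3, ∃ k : Fin 3,
          c * nrm2 (ξ m) ^ 2 ≤ |τ k + σ k * nrm2 (ξ k) ^ 2| := by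
  have hS : 0 < |σ 0| + |σ 1| + |σ 2| := by
    have := abs_pos.mpr (hσ 0)
    positivity
  have h01 : σ 0 + σ 1 ≠ 0 := left_ne_zero_of_mul (left_ne_zero_of_mul hκ)
  have h12 : σ 1 + σ 2 ≠ 0 := right_ne_zero_of_mul (left_ne_zero_of_mul hκ)
  have h20 : σ 2 + σ 0 ≠ 0 := right_ne_zero_of_mul hκ
  obtain ⟨δ, hδ, hδ01, hδ12, hδ20⟩ : ∃ δ > 0, δ ≤ |σ 0 + σ 1| ∧ δ ≤ |σ 1 + σ 2| ∧
      δ ≤ |σ 2 + σ 0| :=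
    ⟨min |σ 0 + σ 1| (min |σ 1 + σ 2| |σ 2 + σ 0|),
      lt_min (abs_pos.mpr h01) (lt_min (abs_pos.mpr h12) (abs_pos.mpr h20)),
      min_le_left _ _, (min_le_right _ _).trans (min_le_left _ _),
      (min_le_right _ _).trans (min_le_right _ _)⟩
  obtain ⟨S, hSdef⟩ : ∃ S, S = |σ 0| + |σ 1| + |σ 2| := ⟨_, rfl⟩
  rw [← hSdef] at hS
  have hε' : δ / (8 * S) ≤ 1 / 4 := by
    rw [div_le_iff₀ (by positivity)]
    linarith [abs_add_le (σ 0) (σ 1), abs_nonneg (σ 0), abs_nonneg (σ 1), abs_nonneg (σ 2)]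
  have hεS : 8 * S * (δ / (8 * S)) ≤ δ := (mul_div_cancel₀ δ (by positivity)).le
  have hε : 0 < δ / (8 * S) := by positivity
  generalize δ / (8 * S) = ε at hε hε' hεS
  refine ⟨ε, hε, δ / 12, by positivity, fun τ ξ hτ hξ ⟨i, j, hij⟩ m => ?_⟩
  have hres : δ / 4 * nrm2 (ξ m) ^ 2 ≤
      |σ 0 * nrm2 (ξ 0) ^ 2 + σ 1 * nrm2 (ξ 1) ^ 2 + σ 2 * nrm2 (ξ 2) ^ 2| := by
    have n0 := nrm2_nonneg (ξ 0)
    have n1 := nrm2_nonneg (ξ 1)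
    have n2 := nrm2_nonneg (ξ 2)
    have of_le {N T : ℝ} (hT : δ / 4 * N ≤ T) (hm : nrm2 (ξ m) ^ 2 ≤ N) :
        δ / 4 * nrm2 (ξ m) ^ 2 ≤ T := by
      refine le_trans ?_ hT
      gcongr
    have q0 := sq_nonneg (nrm2 (ξ 0))
    have q1 := sq_nonneg (nrm2 (ξ 1))
    have q2 := sq_nonneg (nrm2 (ξ 2))
    fin_cases i
    · obtain ⟨hx, hN⟩ := resonance_lower_bound (s := σ 0) n0 n1 n2
        (abs_nrm2_sub_le_of_add_eq_zero hξ) hSdef.ge hδ12 hε hε' hεS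
        (by fin_cases j <;> simp_all)
      refine of_le hN ?_
      fin_cases m <;> simp only [Fin.zero_eta, Fin.mk_one, Fin.reduceFinMk] <;> linarith
    · obtain ⟨hx, hN⟩ := resonance_lower_bound (s := σ 1) n1 n2 n0
        (abs_nrm2_sub_le_of_add_eq_zero (by rw [← hξ]; abel))
        (by linarith) hδ20 hε hε' hεS (by fin_cases j <;> simp_all)
      rw [add_rotate, add_rotate] at hN
      refine of_le hN ?_
      fin_cases m <;> simp only [Fin.zero_eta, Fin.mk_one, Fin.reduceFinMk] <;> linarith
    · obtain ⟨hx, hN⟩ := resonance_lower_bound (s := σ 2) n2 n0 n1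
        (abs_nrm2_sub_le_of_add_eq_zero (by rw [← hξ]; abel))
        (by linarith) hδ01 hε hε' hεS (by fin_cases j <;> simp_all)
      rw [add_rotate] at hN
      refine of_le hN ?_
      fin_cases m <;> simp only [Fin.zero_eta, Fin.mk_one, Fin.reduceFinMk] <;> linarith
  by_contra! hlt
  have hsum : σ 0 * nrm2 (ξ 0) ^ 2 + σ 1 * nrm2 (ξ 1) ^ 2 + σ 2 * nrm2 (ξ 2) ^ 2 =
      (τ 0 + σ 0 * nrm2 (ξ 0) ^ 2) + (τ 1 + σ 1 * nrm2 (ξ 1) ^ 2) +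
        (τ 2 + σ 2 * nrm2 (ξ 2) ^ 2) := by linarith
  rw [hsum] at hres
  linarith [hres.trans (abs_add_three _ _ _), hlt 0, hlt 1, hlt 2]
end

section
/- Let σ₁, σ₂, σ₃ be nonzero real numbers with θ̃ := σ₁σ₂ + σ₂σ₃ + σ₃σ₁ = 0, and set p := sgn(σ₁+σ₃) and q := sgn(σ₃) (note σ₁+σ₃ ≠ 0 since (σ₁+σ₃)(σ₂+σ₃) = σ₃² > 0). Then for all nonzero vectors ξ₁, ξ₂ ∈ ℝ²: |σ₁|ξ₁|² + σ₂|ξ₂|² + σ₃|ξ₁+ξ₂|²| ≥ 2|σ₃| |ξ₁| |ξ₂| (1 + p·q·cos∠(ξ₁,ξ₂)), where ∠(ξ₁,ξ₂) ∈ [0,π] is the angle between ξ₁ and ξ₂. -/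
/-- Dot product on ℝ². -/
noncomputable def dot2 (x y : ℝ × ℝ) : ℝ := x.1 * y.1 + x.2 * y.2

/-- The angle ∠(x,y) ∈ [0,π] between two nonzero vectors of ℝ², defined by
cos∠(x,y) = (x·y)/(|x||y|). -/
noncomputable def angle2 (x y : ℝ × ℝ) : ℝ :=
  Real.arccos (dot2 x y / (nrm2 x * nrm2 y))

theorem nrm2_sq (x : ℝ × ℝ) : nrm2 x ^ 2 = x.1 ^ 2 + x.2 ^ 2 :=
  Real.sq_sqrt (by positivity)

theorem nrm2_pos {x : ℝ × ℝ} (hx : x ≠ 0) : 0 < nrm2 x := by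
  refine (nrm2_nonneg x).lt_of_ne fun h => hx ?_
  have hsq := nrm2_sq x
  rw [← h] at hsq
  have h1 : x.1 = 0 := by nlinarith [sq_nonneg x.1, sq_nonneg x.2]
  have h2 : x.2 = 0 := by nlinarith [sq_nonneg x.1, sq_nonneg x.2]
  exact Prod.ext h1 h2

theorem nrm2_add_sq (x y : ℝ × ℝ) :
    nrm2 (x + y) ^ 2 = nrm2 x ^ 2 + nrm2 y ^ 2 + 2 * dot2 x y := by
  simp only [nrm2_sq, dot2, Prod.fst_add, Prod.snd_add]
  ring

theorem abs_dot2_le (x y : ℝ × ℝ) : |dot2 x y| ≤ nrm2 x * nrm2 y := by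
  refine abs_le_of_sq_le_sq ?_ (mul_nonneg (nrm2_nonneg x) (nrm2_nonneg y))
  rw [mul_pow, nrm2_sq, nrm2_sq, dot2]
  nlinarith [sq_nonneg (x.1 * y.2 - x.2 * y.1)]

theorem nrm2_mul_nrm2_mul_cos_angle2 {x y : ℝ × ℝ} (hx : x ≠ 0) (hy : y ≠ 0) :
    nrm2 x * nrm2 y * Real.cos (angle2 x y) = dot2 x y := by
  have hpos : 0 < nrm2 x * nrm2 y := mul_pos (nrm2_pos hx) (nrm2_pos hy)
  obtain ⟨hl, hu⟩ := abs_le.mp (abs_dot2_le x y)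
  rw [angle2, Real.cos_arccos, mul_div_cancel₀ _ hpos.ne']
  · rw [le_div_iff₀ hpos]
    linarith
  · rwa [div_le_one hpos]

/-- Weighted AM-GM: `2 s a b ≤ A a² + B b²` when `A > 0` and `A B = s²`. -/
theorem two_mul_mul_mul_le_of_mul_eq_sq {A B s : ℝ} (a b : ℝ) (hA : 0 < A)
    (hAB : A * B = s ^ 2) : 2 * s * a * b ≤ A * a ^ 2 + B * b ^ 2 := by
  refine le_of_mul_le_mul_left ?_ hA
  linear_combination sq_nonneg (A * a - s * b) - b ^ 2 * hAB

/-- Let σ₁, σ₂, σ₃ be nonzero reals with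
θ̃ := σ₁σ₂ + σ₂σ₃ + σ₃σ₁ = 0, and set p := sgn(σ₁+σ₃), q := sgn(σ₃). Then for
all nonzero ξ₁, ξ₂ ∈ ℝ²:
|σ₁|ξ₁|² + σ₂|ξ₂|² + σ₃|ξ₁+ξ₂|²| ≥ 2|σ₃||ξ₁||ξ₂|(1 + p·q·cos∠(ξ₁,ξ₂)). -/
theorem stmt4 (σ₁ σ₂ σ₃ : ℝ) (h₁ : σ₁ ≠ 0) (h₂ : σ₂ ≠ 0) (h₃ : σ₃ ≠ 0)
    (hθ : σ₁ * σ₂ + σ₂ * σ₃ + σ₃ * σ₁ = 0) :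
    ∀ ξ₁ ξ₂ : ℝ × ℝ, ξ₁ ≠ 0 → ξ₂ ≠ 0 →
      2 * |σ₃| * nrm2 ξ₁ * nrm2 ξ₂ *
          (1 + Real.sign (σ₁ + σ₃) * Real.sign σ₃ * Real.cos (angle2 ξ₁ ξ₂)) ≤
        |σ₁ * nrm2 ξ₁ ^ 2 + σ₂ * nrm2 ξ₂ ^ 2 + σ₃ * nrm2 (ξ₁ + ξ₂) ^ 2| := by
  intro x y hx hy
  have hcos := nrm2_mul_nrm2_mul_cos_angle2 hx hy
  have hAB : (σ₁ + σ₃) * (σ₂ + σ₃) = |σ₃| ^ 2 := by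
    rw [sq_abs]
    linear_combination hθ
  have hA : σ₁ + σ₃ ≠ 0 := fun h => by
    rw [h, zero_mul] at hAB
    exact pow_ne_zero 2 (abs_ne_zero.mpr h₃) hAB.symm
  have hq : |σ₃| * Real.sign σ₃ = σ₃ := by
    rcases h₃.lt_or_gt with h | h
    · rw [abs_of_neg h, Real.sign_of_neg h]
      ring
    · rw [abs_of_pos h, Real.sign_of_pos h, mul_one]
  have hlhs : 2 * |σ₃| * nrm2 x * nrm2 y *
      (1 + Real.sign (σ₁ + σ₃) * Real.sign σ₃ * Real.cos (angle2 x y)) =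
      2 * |σ₃| * nrm2 x * nrm2 y + Real.sign (σ₁ + σ₃) * (2 * σ₃ * dot2 x y) := by
    linear_combination 2 * Real.sign (σ₁ + σ₃) * (|σ₃| * Real.sign σ₃ * hcos + dot2 x y * hq)
  rw [hlhs, nrm2_add_sq]
  rcases hA.lt_or_gt with h | h
  · rw [Real.sign_of_neg h]
    refine le_trans ?_ (neg_le_abs _)
    have := two_mul_mul_mul_le_of_mul_eq_sq (A := -(σ₁ + σ₃)) (B := -(σ₂ + σ₃))
      (nrm2 x) (nrm2 y) (by linarith) (by rw [neg_mul_neg, hAB])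
    linarith
  · rw [Real.sign_of_pos h]
    refine le_trans ?_ (le_abs_self _)
    have := two_mul_mul_mul_le_of_mul_eq_sq (nrm2 x) (nrm2 y) h hAB
    linarith
end

section
/- Let σ₁, σ₂, σ₃ be nonzero real numbers with θ̃ := σ₁σ₂ + σ₂σ₃ + σ₃σ₁ = 0. Then there exists C > 0, depending only on σ₁, σ₂, σ₃, such that for all A ≥ 1, N > 0, all nonzero ξ₁, ξ₂ ∈ ℝ² and all τ₁, τ₂, τ₃ ∈ ℝ with τ₁ + τ₂ + τ₃ = 0, setting ξ₃ := −ξ₁ − ξ₂: if |ξ₁| ≥ N/2, |ξ₂| ≥ N/2, and max_{1≤k≤3} |τ_k + σ_k|ξ_k|²| ≤ N²/A², then min( ∠(ξ₁,ξ₂), π − ∠(ξ₁,ξ₂) ) ≤ C/A, i.e. ξ₁ and ξ₂ are either nearly parallel or nearly antiparallel. -/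
/-- Jordan's inequality, applied on whichever side of `π / 2` the angle lies. -/
theorem min_le_pi_div_two_mul_sin {θ : ℝ} (h0 : 0 ≤ θ) (hπ : θ ≤ Real.pi) :
    min θ (Real.pi - θ) ≤ Real.pi / 2 * Real.sin θ := by
  have jordan : ∀ x : ℝ, 0 ≤ x → x ≤ Real.pi / 2 → x ≤ Real.pi / 2 * Real.sin x := by
    intro x hx hx'
    calc x = Real.pi / 2 * (2 / Real.pi * x) := by field_simp
      _ ≤ Real.pi / 2 * Real.sin x := by
        gcongr
        exact Real.mul_le_sin hx hx'
  rcases le_total θ (Real.pi / 2) with h | h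
  · exact (min_le_left _ _).trans (jordan θ h0 h)
  · refine (min_le_right _ _).trans ?_
    have := jordan (Real.pi - θ) (by linarith) (by linarith)
    rwa [Real.sin_pi_sub] at this

/-- When `θ̃ = 0`, the resonance function is, up to the factor `σ₁ + σ₃`, a perfect square. -/
theorem resonance_mul_eq {σ₁ σ₂ σ₃ : ℝ} (hθ : σ₁ * σ₂ + σ₂ * σ₃ + σ₃ * σ₁ = 0)
    (x y : ℝ × ℝ) :
    (σ₁ + σ₃) * (σ₁ * nrm2 x ^ 2 + σ₂ * nrm2 y ^ 2 + σ₃ * nrm2 (-x - y) ^ 2) =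
      nrm2 ((σ₁ + σ₃) • x + σ₃ • y) ^ 2 := by
  simp only [nrm2_sq, Prod.fst_add, Prod.snd_add, Prod.fst_sub, Prod.snd_sub, Prod.fst_neg,
    Prod.snd_neg, Prod.smul_fst, Prod.smul_snd, smul_eq_mul]
  linear_combination (y.1 ^ 2 + y.2 ^ 2) * hθ

/-- The area spanned by `x` and `y` is controlled by any combination `a x + b y`. -/
theorem sq_mul_gram_le (a b : ℝ) (x y : ℝ × ℝ) :
    b ^ 2 * (nrm2 x ^ 2 * nrm2 y ^ 2 - dot2 x y ^ 2) ≤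
      nrm2 x ^ 2 * nrm2 (a • x + b • y) ^ 2 := by
  simp only [nrm2_sq, dot2, Prod.fst_add, Prod.snd_add, Prod.smul_fst, Prod.smul_snd,
    smul_eq_mul]
  linarith [sq_nonneg (x.1 * (a * x.1 + b * y.1) + x.2 * (a * x.2 + b * y.2))]

/-- Let σ₁, σ₂, σ₃ be nonzero reals with
θ̃ := σ₁σ₂ + σ₂σ₃ + σ₃σ₁ = 0. Then there exists C > 0 (depending only on the
σ's) such that for all A ≥ 1, N > 0, all nonzero ξ₁, ξ₂ ∈ ℝ² and all
τ₁, τ₂, τ₃ ∈ ℝ with τ₁ + τ₂ + τ₃ = 0, setting ξ₃ := −ξ₁ − ξ₂: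
if |ξ₁| ≥ N/2, |ξ₂| ≥ N/2 and max_k |τ_k + σ_k|ξ_k|²| ≤ N²/A², then
min(∠(ξ₁,ξ₂), π − ∠(ξ₁,ξ₂)) ≤ C/A. -/
theorem stmt5 (σ₁ σ₂ σ₃ : ℝ) (h₁ : σ₁ ≠ 0) (h₂ : σ₂ ≠ 0) (h₃ : σ₃ ≠ 0)
    (hθ : σ₁ * σ₂ + σ₂ * σ₃ + σ₃ * σ₁ = 0) :
    ∃ C > (0 : ℝ),
      ∀ (A N : ℝ) (ξ₁ ξ₂ : ℝ × ℝ) (τ₁ τ₂ τ₃ : ℝ),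
        1 ≤ A → 0 < N → ξ₁ ≠ 0 → ξ₂ ≠ 0 → τ₁ + τ₂ + τ₃ = 0 →
        N / 2 ≤ nrm2 ξ₁ → N / 2 ≤ nrm2 ξ₂ →
        |τ₁ + σ₁ * nrm2 ξ₁ ^ 2| ≤ N ^ 2 / A ^ 2 →
        |τ₂ + σ₂ * nrm2 ξ₂ ^ 2| ≤ N ^ 2 / A ^ 2 →
        |τ₃ + σ₃ * nrm2 (-ξ₁ - ξ₂) ^ 2| ≤ N ^ 2 / A ^ 2 →
        min (angle2 ξ₁ ξ₂) (Real.pi - angle2 ξ₁ ξ₂) ≤ C / A := by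
  refine ⟨Real.pi / 2 * Real.sqrt (12 * |σ₁ + σ₃| / σ₃ ^ 2) + 1, by positivity, ?_⟩
  intro A N ξ₁ ξ₂ τ₁ τ₂ τ₃ hA hN _ _ hτ hr hs e₁ e₂ e₃
  have hA0 : 0 < A := by linarith
  have hr0 : 0 < nrm2 ξ₁ := by linarith
  have hs0 : 0 < nrm2 ξ₂ := by linarith
  have hσ : 0 < σ₃ ^ 2 := by positivity
  have hH : |σ₁ * nrm2 ξ₁ ^ 2 + σ₂ * nrm2 ξ₂ ^ 2 + σ₃ * nrm2 (-ξ₁ - ξ₂) ^ 2| ≤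
      3 * (N ^ 2 / A ^ 2) := by
    rw [abs_le] at *
    constructor <;> linarith
  have hw : nrm2 ((σ₁ + σ₃) • ξ₁ + σ₃ • ξ₂) ^ 2 ≤ |σ₁ + σ₃| * (3 * (N ^ 2 / A ^ 2)) := by
    rw [← resonance_mul_eq hθ]
    refine (le_abs_self _).trans ?_
    rw [abs_mul]
    gcongr
  have hN2 : N ^ 2 ≤ 4 * nrm2 ξ₂ ^ 2 := by nlinarith
  have hgram : σ₃ ^ 2 * (nrm2 ξ₁ ^ 2 * nrm2 ξ₂ ^ 2 - dot2 ξ₁ ξ₂ ^ 2) ≤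
      nrm2 ξ₁ ^ 2 * (|σ₁ + σ₃| * (3 * (4 * nrm2 ξ₂ ^ 2 / A ^ 2))) := by
    refine (sq_mul_gram_le (σ₁ + σ₃) σ₃ ξ₁ ξ₂).trans ?_
    gcongr
    exact hw.trans (by gcongr)
  have hsin : Real.sin (angle2 ξ₁ ξ₂) ≤ Real.sqrt (12 * |σ₁ + σ₃| / σ₃ ^ 2) / A := by
    rw [angle2, Real.sin_arccos, ← Real.sqrt_sq hA0.le, ← Real.sqrt_div (by positivity)]
    apply Real.sqrt_le_sqrt
    have hc : 1 - (dot2 ξ₁ ξ₂ / (nrm2 ξ₁ * nrm2 ξ₂)) ^ 2 =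
        σ₃ ^ 2 * (nrm2 ξ₁ ^ 2 * nrm2 ξ₂ ^ 2 - dot2 ξ₁ ξ₂ ^ 2) /
          (σ₃ ^ 2 * (nrm2 ξ₁ ^ 2 * nrm2 ξ₂ ^ 2)) := by
      field_simp
    rw [hc, div_le_iff₀ (by positivity)]
    refine hgram.trans_eq ?_
    field_simp
    ring
  calc min (angle2 ξ₁ ξ₂) (Real.pi - angle2 ξ₁ ξ₂)
      ≤ Real.pi / 2 * Real.sin (angle2 ξ₁ ξ₂) :=
        min_le_pi_div_two_mul_sin (Real.arccos_nonneg _) (Real.arccos_le_pi _)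
    _ ≤ Real.pi / 2 * (Real.sqrt (12 * |σ₁ + σ₃| / σ₃ ^ 2) / A) := by gcongr
    _ = Real.pi / 2 * Real.sqrt (12 * |σ₁ + σ₃| / σ₃ ^ 2) / A := by ring
    _ ≤ (Real.pi / 2 * Real.sqrt (12 * |σ₁ + σ₃| / σ₃ ^ 2) + 1) / A := by
      gcongr
      linarith
end

section
/- There exist τ₀ ∈ (0, 1) and c > 0 such that for every τ ∈ (0, τ₀] and every q ∈ [0, 1]: ∫₀^{√(2π/τ − q)} sin(τ(q + y²)) / (q + y²) dy ≥ c √τ. -/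
open Real MeasureTheory

/-- The function `u ↦ sin u / u` dominates a multiple of `r (3π - u) sin u` on `(0, 2π]` when
`r ≤ 1` before the sign change of the sine and `1 ≤ r` after it. -/
lemma mul_sin_le_sin_div {u r : ℝ} (hu : 0 < u) (hu2 : u ≤ 2 * π) (hr : 0 ≤ r)
    (h1 : u ≤ π → r ≤ 1) (h2 : π ≤ u → 1 ≤ r) :
    r * ((3 * π - u) * sin u) / (2 * π ^ 2) ≤ sin u / u := by
  have hπ := pi_pos
  rw [div_le_div_iff₀ (by positivity) hu]
  rcases le_total u π with h | h
  · have hs : 0 ≤ sin u := sin_nonneg_of_nonneg_of_le_pi hu.le h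
    have hw : u * (3 * π - u) ≤ 2 * π ^ 2 := by nlinarith
    have hw0 : 0 ≤ u * (3 * π - u) := mul_nonneg hu.le (by linarith)
    have hk : r * (u * (3 * π - u)) ≤ 2 * π ^ 2 := by nlinarith [h1 h]
    nlinarith [mul_le_mul_of_nonneg_right hk hs]
  · have hs : sin u ≤ 0 := by
      have := sin_nonneg_of_nonneg_of_le_pi (x := u - π) (by linarith) (by linarith)
      rw [sin_sub_pi] at this
      linarith
    have hw : 2 * π ^ 2 ≤ u * (3 * π - u) := by nlinarith
    have hw0 : 0 ≤ u * (3 * π - u) := mul_nonneg hu.le (by linarith)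
    have hk : 2 * π ^ 2 ≤ r * (u * (3 * π - u)) := by nlinarith [h2 h]
    nlinarith [mul_le_mul_of_nonpos_right hk hs]

lemma integral_mul_sub_mul_sin (τ q B : ℝ) (hτ : τ ≠ 0) :
    ∫ y in (0 : ℝ)..B, y * ((3 * π - τ * (q + y ^ 2)) * sin (τ * (q + y ^ 2))) =
      ((3 * π - τ * q) * cos (τ * q) + sin (τ * q)
        - ((3 * π - τ * (q + B ^ 2)) * cos (τ * (q + B ^ 2)) + sin (τ * (q + B ^ 2))))
          / (2 * τ) := by
  have hd (y : ℝ) : HasDerivAt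
      (fun y : ℝ ↦ -((3 * π - τ * (q + y ^ 2)) * cos (τ * (q + y ^ 2))
        + sin (τ * (q + y ^ 2))) / (2 * τ))
      (y * ((3 * π - τ * (q + y ^ 2)) * sin (τ * (q + y ^ 2)))) y := by
    have hu : HasDerivAt (fun y : ℝ ↦ τ * (q + y ^ 2)) (τ * (2 * y)) y := by
      simpa using ((hasDerivAt_pow 2 y).const_add q).const_mul τ
    refine (((((hu.const_sub (3 * π)).mul hu.cos).add hu.sin).neg.div_const (2 * τ))).congr_deriv ?_
    field_simp
    ring
  rw [intervalIntegral.integral_eq_sub_of_hasDerivAt (fun y _ ↦ hd y)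
    ((by fun_prop : Continuous _).intervalIntegrable _ _)]
  simp only [ne_eq, OfNat.ofNat_ne_zero, not_false_eq_true, zero_pow, add_zero]
  ring

lemma intervalIntegrable_sin_mul_div (τ q B : ℝ) (hτ : 0 < τ) (hq : 0 ≤ q) (hB : 0 ≤ B) :
    IntervalIntegrable (fun y : ℝ ↦ sin (τ * (q + y ^ 2)) / (q + y ^ 2)) volume 0 B := by
  have hc : Continuous fun y : ℝ ↦ τ * sinc (τ * (q + y ^ 2)) :=
    continuous_const.mul (continuous_sinc.comp (by fun_prop))
  refine (hc.intervalIntegrable 0 B).congr fun y hy ↦ ?_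
  rw [Set.uIoc_of_le hB] at hy
  have hy0 : 0 < y := hy.1
  have hx : 0 < q + y ^ 2 := by positivity
  simp only [sinc_of_ne_zero (mul_pos hτ hx).ne']
  field_simp

/-- There exist τ₀ ∈ (0, 1) and c > 0 such that for every
τ ∈ (0, τ₀] and every q ∈ [0, 1]:
∫₀^{√(2π/τ − q)} sin(τ(q + y²)) / (q + y²) dy ≥ c √τ. -/
theorem stmt19 :
    ∃ τ₀ ∈ Set.Ioo (0 : ℝ) 1, ∃ c > (0 : ℝ),
      ∀ τ ∈ Set.Ioc (0 : ℝ) τ₀, ∀ q ∈ Set.Icc (0 : ℝ) 1,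
        c * Real.sqrt τ ≤
          ∫ y in (0 : ℝ)..(Real.sqrt (2 * Real.pi / τ - q)),
            Real.sin (τ * (q + y ^ 2)) / (q + y ^ 2) := by
  have hπ := pi_pos
  have hπ3 := pi_gt_three
  refine ⟨1 / 2, by norm_num, 1 / (4 * π ^ 2 * √π), by positivity, ?_⟩
  rintro τ ⟨hτ, hτ2⟩ q ⟨hq0, hq1⟩
  have hπτ : 1 < π / τ := by rw [lt_div_iff₀ hτ]; linarith
  have h2πτ : 2 * π / τ = 2 * (π / τ) := by ring
  set A := √(π / τ - q) with hA
  set B := √(2 * π / τ - q) with hB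
  have hA0 : 0 < A := sqrt_pos.2 (by linarith)
  have hA2 : τ * (q + A ^ 2) = π := by
    rw [hA, sq_sqrt (by linarith)]; field_simp; ring
  have hB0 : 0 ≤ B := sqrt_nonneg _
  have hB2 : τ * (q + B ^ 2) = 2 * π := by
    rw [hB, sq_sqrt (by linarith)]; field_simp; ring
  have hAle : √τ * A ≤ √π := by
    rw [hA, ← sqrt_mul hτ.le]
    apply sqrt_le_sqrt
    have : τ * (π / τ - q) = π - τ * q := by field_simp
    nlinarith
  have hmono : ∫ y in (0 : ℝ)..B, τ / (2 * π ^ 2 * A) *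
        (y * ((3 * π - τ * (q + y ^ 2)) * sin (τ * (q + y ^ 2)))) ≤
      ∫ y in (0 : ℝ)..B, sin (τ * (q + y ^ 2)) / (q + y ^ 2) := by
    refine intervalIntegral.integral_mono_on_of_le_Ioo hB0
      ((by fun_prop : Continuous _).intervalIntegrable _ _)
      (intervalIntegrable_sin_mul_div τ q B hτ hq0 hB0) fun y hy ↦ ?_
    have hy0 : 0 < y := hy.1
    have hx : 0 < q + y ^ 2 := by positivity
    have hu2 : τ * (q + y ^ 2) ≤ 2 * π := by
      rw [← hB2]; gcongr; exact hy.2.le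
    have key := mul_sin_le_sin_div (u := τ * (q + y ^ 2)) (r := y / A) (by positivity) hu2
      (by positivity)
      (fun h ↦ by
        rw [← hA2, mul_le_mul_iff_right₀ hτ, add_le_add_iff_left] at h
        exact (div_le_one hA0).2 (le_of_sq_le_sq h hA0.le))
      (fun h ↦ by
        rw [← hA2, mul_le_mul_iff_right₀ hτ, add_le_add_iff_left] at h
        exact (one_le_div hA0).2 (le_of_sq_le_sq h hy0.le))
    calc _ = τ * (y / A * ((3 * π - τ * (q + y ^ 2)) * sin (τ * (q + y ^ 2))) / (2 * π ^ 2)) := by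
          field_simp
      _ ≤ τ * (sin (τ * (q + y ^ 2)) / (τ * (q + y ^ 2))) := by gcongr
      _ = _ := by field_simp
  refine le_trans ?_ hmono
  rw [intervalIntegral.integral_const_mul, integral_mul_sub_mul_sin τ q B hτ.ne', hB2,
    cos_two_pi, sin_two_pi]
  have ha0 : 0 ≤ τ * q := by positivity
  have ha1 : τ * q ≤ 1 / 2 := by nlinarith
  have hcos : 7 / 8 ≤ cos (τ * q) := by
    have := one_sub_sq_div_two_le_cos (x := τ * q)
    nlinarith
  have hsin : 0 ≤ sin (τ * q) := sin_nonneg_of_nonneg_of_le_pi ha0 (by linarith)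
  have hnum : 1 ≤ (3 * π - τ * q) * cos (τ * q) + sin (τ * q)
      - ((3 * π - 2 * π) * 1 + 0) := by nlinarith
  calc 1 / (4 * π ^ 2 * √π) * √τ ≤ 1 / (4 * π ^ 2 * A) := by
        rw [one_div_mul_eq_div, div_le_div_iff₀ (by positivity) (by positivity)]
        nlinarith [mul_le_mul_of_nonneg_left hAle (by positivity : 0 ≤ 4 * π ^ 2)]
    _ = τ / (2 * π ^ 2 * A) * (1 / (2 * τ)) := by field_simp; norm_num
    _ ≤ _ := by gcongr
end
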